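/- arXiv:1906.08229 — 2 statements merged into one kernel-verified Lean document; each statement's English description precedes it below -/
import Mathlib

section
/- Let q : ℝ³ → ℍ be differentiable with |q(x)| = 1 for all x. Then for every 1 ≤ l ≤ 3, ε(K_e^l(q)) = Re(q)ᵗ · ∂_l Re(q), where Re(q) is the matrix of v ↦ q v q̄, K_e^l(q) := 2 q̄ ∂_l q, and ε is the alternating skew tensor. -/
noncomputable section
open Quaternion Matrix

/-- Identification of `ℝ³` with the pure quaternions. -/
def toQ (v : Fin 3 → ℝ) : ℍ[ℝ] := ⟨0, v 0, v 1, v 2⟩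

/-- The vector (imaginary) part of a quaternion, as a vector in `ℝ³`. -/
def imVec (p : ℍ[ℝ]) : Fin 3 → ℝ := ![p.imI, p.imJ, p.imK]

/-- The matrix `Re(q)` of the linear map `v ↦ q v q̄` on `ℝ³ ≅` pure quaternions. -/
def Rot (q : ℍ[ℝ]) : Matrix (Fin 3) (Fin 3) ℝ :=
  Matrix.of fun i j => imVec (q * toQ (Pi.single j 1) * star q) i

/-- The alternating skew tensor `ε`. -/
def skewMat (v : Fin 3 → ℝ) : Matrix (Fin 3) (Fin 3) ℝ :=
  !![0, -v 2, v 1; v 2, 0, -v 0; -v 1, v 0, 0]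

/-- Partial derivative `∂_l` of a quaternion-valued field. -/
def pd (l : Fin 3) (q : (Fin 3 → ℝ) → ℍ[ℝ]) (x : Fin 3 → ℝ) : ℍ[ℝ] :=
  fderiv ℝ q x (Pi.single l 1)

/-- Entrywise partial derivative `∂_l` of a matrix-valued field. -/
def pdM (l : Fin 3) (R : (Fin 3 → ℝ) → Matrix (Fin 3) (Fin 3) ℝ) (x : Fin 3 → ℝ) :
    Matrix (Fin 3) (Fin 3) ℝ :=
  Matrix.of fun i j => fderiv ℝ (fun y => R y i j) x (Pi.single l 1)

/-- The `m`-th curvature (Darboux) vector `K_e^m(q) = 2 q̄ ∂_m q`, as a quaternion. -/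
def Ke (m : Fin 3) (q : (Fin 3 → ℝ) → ℍ[ℝ]) (x : Fin 3 → ℝ) : ℍ[ℝ] :=
  2 * star (q x) * pd m q x

/-- The `i`-th coordinate of the imaginary part, as a continuous linear functional. -/
def imVecCLM (i : Fin 3) : ℍ[ℝ] →L[ℝ] ℝ :=
  LinearMap.toContinuousLinearMap
    { toFun := fun p => imVec p i
      map_add' := fun a b => by fin_cases i <;> simp [imVec]
      map_smul' := fun r a => by fin_cases i <;> simp [imVec] }

@[simp]
lemma imVecCLM_apply (i : Fin 3) (p : ℍ[ℝ]) : imVecCLM i p = imVec p i := rfl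

@[simp]
lemma toQ_re (v : Fin 3 → ℝ) : (toQ v).re = 0 := rfl

@[simp]
lemma toQ_imI (v : Fin 3 → ℝ) : (toQ v).imI = v 0 := rfl

@[simp]
lemma toQ_imJ (v : Fin 3 → ℝ) : (toQ v).imJ = v 1 := rfl

@[simp]
lemma toQ_imK (v : Fin 3 → ℝ) : (toQ v).imK = v 2 := rfl

lemma hasFDerivAt_mul_mul_star {E : Type*} [NormedAddCommGroup E] [NormedSpace ℝ E]
    {q : E → ℍ[ℝ]} {x : E} (hq : DifferentiableAt ℝ q x) (e : ℍ[ℝ]) :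
    ∃ D : E →L[ℝ] ℍ[ℝ], HasFDerivAt (fun y => q y * e * star (q y)) D x ∧
      ∀ v, D v = q x * e * star (fderiv ℝ q x v) + fderiv ℝ q x v * e * star (q x) :=
  have : StarModule ℝ ℍ[ℝ] := ⟨fun r a => by simp⟩
  ⟨_, (hq.hasFDerivAt.mul_const' e).fun_mul' hq.hasFDerivAt.star, fun v => by simp⟩

lemma pdM_rot {q : (Fin 3 → ℝ) → ℍ[ℝ]} {x : Fin 3 → ℝ} (hq : DifferentiableAt ℝ q x)
    (l i j : Fin 3) :
    pdM l (fun y => Rot (q y)) x i j =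
      imVec (q x * toQ (Pi.single j 1) * star (pd l q x) +
        pd l q x * toQ (Pi.single j 1) * star (q x)) i := by
  obtain ⟨D, hD, hDv⟩ := hasFDerivAt_mul_mul_star hq (toQ (Pi.single j 1))
  have h : HasFDerivAt (fun y => Rot (q y) i j) ((imVecCLM i).comp D) x :=
    (imVecCLM i).hasFDerivAt.comp x hD
  simp only [pdM, Matrix.of_apply, h.fderiv, ContinuousLinearMap.comp_apply, hDv,
    imVecCLM_apply, pd]

lemma mul_star_pd_add_pd_mul_star {q : (Fin 3 → ℝ) → ℍ[ℝ]} {x : Fin 3 → ℝ}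
    (hq : DifferentiableAt ℝ q x) (hunit : ∀ y, ‖q y‖ = 1) (l : Fin 3) :
    q x * star (pd l q x) + pd l q x * star (q x) = 0 := by
  obtain ⟨D, hD, hDv⟩ := hasFDerivAt_mul_mul_star hq 1
  have hc : (fun y => q y * 1 * star (q y)) = fun _ => 1 := by
    funext y
    simp [Quaternion.self_mul_star, Quaternion.normSq_eq_norm_mul_self, hunit y]
  rw [hc] at hD
  have h := hDv (Pi.single l 1)
  rw [hD.unique (hasFDerivAt_const _ _)] at h
  simpa [pd] using h.symm

/-- The pointwise identity behind the theorem: `p` is a unit quaternion and `d` is tangent to the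
unit sphere at `p`. -/
lemma skewMat_imVec_two_mul_star_mul {p d : ℍ[ℝ]} (hp : ‖p‖ = 1)
    (hd : p * star d + d * star p = 0) :
    skewMat (imVec (2 * star p * d)) =
      (Rot p)ᵀ * Matrix.of fun i j => imVec (p * toQ (Pi.single j 1) * star d +
        d * toQ (Pi.single j 1) * star p) i := by
  have hN : p.re * p.re + p.imI * p.imI + p.imJ * p.imJ + p.imK * p.imK = 1 := by
    have h := Quaternion.normSq_eq_norm_mul_self p
    rw [hp, Quaternion.normSq_def'] at h
    linarith
  have hS : p.re * d.re + p.imI * d.imI + p.imJ * d.imJ + p.imK * d.imK = 0 := by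
    have h := congrArg (fun z : ℍ[ℝ] => z.re) hd
    simp at h
    linarith
  have h2 : (2 : ℍ[ℝ]) * star p * d = (2 : ℝ) • (star p * d) := by
    rw [mul_assoc, two_mul, two_smul]
  rw [h2]
  have key : ∀ i j, ((Rot p)ᵀ * Matrix.of fun i j => imVec (p * toQ (Pi.single j 1) * star d +
        d * toQ (Pi.single j 1) * star p) i) i j =
      (p.re * p.re + p.imI * p.imI + p.imJ * p.imJ + p.imK * p.imK) *
        (skewMat (imVec ((2 : ℝ) • (star p * d))) i j +
          2 * (p.re * d.re + p.imI * d.imI + p.imJ * d.imJ + p.imK * d.imK) *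
            (1 : Matrix (Fin 3) (Fin 3) ℝ) i j) := by
    intro i j
    fin_cases i <;> fin_cases j <;>
      simp [skewMat, imVec, Rot, Matrix.mul_apply, Fin.sum_univ_three] <;>
      ring
  ext i j
  rw [key, hN, hS]
  ring

/-- For a differentiable unit-quaternion field `q`, one has
`ε(K_e^l(q)) = Re(q)ᵗ · ∂_l Re(q)`. -/
theorem skew_curvature_eq_transpose_mul_deriv (q : (Fin 3 → ℝ) → ℍ[ℝ])
    (hq : Differentiable ℝ q) (hunit : ∀ x, ‖q x‖ = 1) (l : Fin 3) (x : Fin 3 → ℝ) :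
    skewMat (imVec (Ke l q x)) = (Rot (q x))ᵀ * pdM l (fun y => Rot (q y)) x := by
  rw [Ke, skewMat_imVec_two_mul_star_mul (hunit x) (mul_star_pd_add_pd_mul_star (hq x) hunit l)]
  congr 1
  ext i j
  rw [pdM_rot (hq x), Matrix.of_apply]
end
end

section
/- Let q : ℝ³ → ℍ be differentiable with |q(x)| = 1 for all x. Then at every x, Σ_{l=1}^{3} ‖∂_l Re(q)‖² = 2 Σ_{l=1}^{3} |K_e^l(q)|², where ‖·‖ is the Frobenius norm, Re(q) is the matrix of v ↦ q v q̄, and K_e^l(q) := 2 q̄ ∂_l q. Consequently the curvature energy W_c(q) := μ₂ Σ_l ‖∂_l Re(q)‖² equals 2 μ₂ Σ_l |K_e^l(q)|² for any μ₂ ∈ ℝ. -/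
noncomputable section
open Quaternion Matrix

/-- The coordinates of the vector part, as a linear map. -/
def imVecLinear (i : Fin 3) : ℍ[ℝ] →ₗ[ℝ] ℝ where
  toFun p := imVec p i
  map_add' p r := by fin_cases i <;> simp [imVec]
  map_smul' c p := by fin_cases i <;> simp [imVec]

lemma fderiv_imVec_conj {q : (Fin 3 → ℝ) → ℍ[ℝ]} {x : Fin 3 → ℝ}
    (hq : DifferentiableAt ℝ q x) (c : ℍ[ℝ]) (i : Fin 3) (v : Fin 3 → ℝ) :
    fderiv ℝ (fun y => imVec (q y * c * star (q y)) i) x v =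
      imVec (fderiv ℝ q x v * c * star (q x) + q x * c * star (fderiv ℝ q x v)) i := by
  have : StarModule ℝ ℍ[ℝ] := ⟨fun r p => by simp [Quaternion.star_smul]⟩
  have h := (hq.hasFDerivAt.mul_const' c).mul' hq.hasFDerivAt.star
  have h2 := (LinearMap.toContinuousLinearMap (imVecLinear i)).hasFDerivAt.comp x h
  have h3 : fderiv ℝ (fun y => imVec (q y * c * star (q y)) i) x = _ := h2.fderiv
  rw [h3]
  rw [add_comm (fderiv ℝ q x v * c * star (q x))]
  rfl

/-- The derivative of a unit field is orthogonal to the field. -/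
lemma inner_fderiv_eq_zero_of_norm_eq_one {q : (Fin 3 → ℝ) → ℍ[ℝ]} {x : Fin 3 → ℝ}
    (hq : DifferentiableAt ℝ q x) (hunit : ∀ x, ‖q x‖ = 1) (v : Fin 3 → ℝ) :
    inner ℝ (q x) (fderiv ℝ q x v) = 0 := by
  have h := hq.hasFDerivAt.norm_sq
  have hc : (fun y => ‖q y‖ ^ 2) = fun _ => (1 : ℝ) := by
    funext y
    simp [hunit y]
  rw [hc] at h
  have h2 := congrArg (fun L => L v) (h.unique (hasFDerivAt_const (1 : ℝ) x))
  simpa using h2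

lemma quaternion_norm_sq (p : ℍ[ℝ]) :
    ‖p‖ ^ 2 = p.re ^ 2 + p.imI ^ 2 + p.imJ ^ 2 + p.imK ^ 2 := by
  rw [sq ‖p‖, ← Quaternion.normSq_eq_norm_mul_self, Quaternion.normSq_def']

/-- The squared Frobenius norm of the differential of `q ↦ Re(q)` at `q` in direction `p`. -/
lemma sum_sq_imVec_conj (q p : ℍ[ℝ]) :
    ∑ j : Fin 3, ∑ i : Fin 3,
      imVec (p * toQ (Pi.single j 1) * star q + q * toQ (Pi.single j 1) * star p) i ^ 2 =
      8 * (‖q‖ ^ 2 * ‖p‖ ^ 2) + 4 * inner ℝ q p ^ 2 := by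
  rw [quaternion_norm_sq, quaternion_norm_sq, Quaternion.inner_def]
  simp only [Fin.sum_univ_three, imVec, Matrix.cons_val, Quaternion.re_mul,
    Quaternion.imI_mul, Quaternion.imJ_mul, Quaternion.imK_mul,
    Quaternion.imI_add, Quaternion.imJ_add, Quaternion.imK_add, Quaternion.re_star,
    Quaternion.imI_star, Quaternion.imJ_star, Quaternion.imK_star]
  simp only [toQ, Pi.single_apply, Fin.isValue, Fin.reduceEq, if_true, if_false]
  ring

lemma norm_Ke_sq (m : Fin 3) (q : (Fin 3 → ℝ) → ℍ[ℝ]) (x : Fin 3 → ℝ) :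
    ‖Ke m q x‖ ^ 2 = 4 * (‖q x‖ ^ 2 * ‖pd m q x‖ ^ 2) := by
  have h2 : ‖(2 : ℍ[ℝ])‖ = 2 := by
    have h := Quaternion.norm_coe (2 : ℝ)
    rwa [Real.norm_ofNat] at h
  rw [Ke, norm_mul, norm_mul, Quaternion.norm_star, h2]
  ring

lemma trace_pdM_Rot {q : (Fin 3 → ℝ) → ℍ[ℝ]} {x : Fin 3 → ℝ}
    (hq : DifferentiableAt ℝ q x) (hunit : ∀ x, ‖q x‖ = 1) (l : Fin 3) :
    Matrix.trace ((pdM l (fun y => Rot (q y)) x)ᵀ * pdM l (fun y => Rot (q y)) x) =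
      2 * ‖Ke l q x‖ ^ 2 := by
  have h := sum_sq_imVec_conj (q x) (pd l q x)
  rw [pd, inner_fderiv_eq_zero_of_norm_eq_one hq hunit] at h
  rw [norm_Ke_sq, pd]
  simp only [Matrix.trace, Matrix.diag, Matrix.mul_apply, Matrix.transpose_apply, pdM, Rot,
    Matrix.of_apply, fderiv_imVec_conj hq, ← sq]
  rw [h]
  ring

/-- For a differentiable unit-quaternion field `q`:
`Σ_l ‖∂_l Re(q)‖² = 2 Σ_l |K_e^l(q)|²` (Frobenius norm on the left, quaternion modulus on
the right); consequently `μ₂ Σ_l ‖∂_l Re(q)‖² = 2 μ₂ Σ_l |K_e^l(q)|²` for any `μ₂`. -/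
theorem curvature_energy_eq (q : (Fin 3 → ℝ) → ℍ[ℝ])
    (hq : Differentiable ℝ q) (hunit : ∀ x, ‖q x‖ = 1) (x : Fin 3 → ℝ) :
    (∑ l : Fin 3, Matrix.trace ((pdM l (fun y => Rot (q y)) x)ᵀ * pdM l (fun y => Rot (q y)) x)
      = 2 * ∑ l : Fin 3, ‖Ke l q x‖ ^ 2) ∧
    (∀ μ₂ : ℝ,
      μ₂ * ∑ l : Fin 3, Matrix.trace
          ((pdM l (fun y => Rot (q y)) x)ᵀ * pdM l (fun y => Rot (q y)) x)
        = 2 * μ₂ * ∑ l : Fin 3, ‖Ke l q x‖ ^ 2) := by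
  have h : ∑ l : Fin 3, Matrix.trace
      ((pdM l (fun y => Rot (q y)) x)ᵀ * pdM l (fun y => Rot (q y)) x)
      = 2 * ∑ l : Fin 3, ‖Ke l q x‖ ^ 2 := by
    rw [Finset.mul_sum]
    exact Finset.sum_congr rfl fun l _ => trace_pdM_Rot (hq x) hunit l
  refine ⟨h, fun μ₂ => ?_⟩
  rw [h]
  ring
end
end
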